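/- Let π be a unitary representation of a group G on a Hilbert space H. Then π⊗π̄ (realized on the Hilbert–Schmidt operators L²(H) by T ↦ π(x)Tπ(x)⁻¹) has a nonzero invariant vector if and only if π contains a nonzero finite-dimensional subrepresentation. -/

import Mathlib

open ContinuousLinearMap
open scoped InnerProductSpace

/-- A Hilbert–Schmidt operator is compact. -/
theorem isCompactOperator_of_summable_sq
    {H ι : Type*} [NormedAddCommGroup H] [InnerProductSpace ℂ H] [CompleteSpace H]
    (e : HilbertBasis ι ℂ H) (T : H →L[ℂ] H) (hT : Summable fun i => ‖T (e i)‖ ^ 2) :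
    IsCompactOperator T := by
  classical
  let R : ι → H →L[ℂ] H := fun i => (innerSL ℂ (e i)).smulRight (T (e i))
  have hRa : ∀ i x, R i x = ⟪e i, x⟫_ℂ • T (e i) := fun i x => rfl
  have hbound : ∀ t : Finset ι, ‖∑ i ∈ t, R i‖ ≤ √(∑ i ∈ t, ‖T (e i)‖ ^ 2) := by
    intro t
    refine ContinuousLinearMap.opNorm_le_bound _ (Real.sqrt_nonneg _) fun x => ?_
    have h1 : ∑ i ∈ t, ‖⟪e i, x⟫_ℂ‖ ^ 2 ≤ ‖x‖ ^ 2 := e.orthonormal.sum_inner_products_le x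
    calc ‖(∑ i ∈ t, R i) x‖ = ‖∑ i ∈ t, ⟪e i, x⟫_ℂ • T (e i)‖ := by
          rw [_root_.sum_apply]; rfl
      _ ≤ ∑ i ∈ t, ‖T (e i)‖ * ‖⟪e i, x⟫_ℂ‖ := by
          refine (norm_sum_le _ _).trans (le_of_eq ?_)
          exact Finset.sum_congr rfl fun i _ => by rw [norm_smul, mul_comm]
      _ ≤ √(∑ i ∈ t, ‖T (e i)‖ ^ 2) * √(∑ i ∈ t, ‖⟪e i, x⟫_ℂ‖ ^ 2) :=
          Real.sum_mul_le_sqrt_mul_sqrt _ _ _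
      _ ≤ √(∑ i ∈ t, ‖T (e i)‖ ^ 2) * ‖x‖ := by
          gcongr
          exact Real.sqrt_le_iff.2 ⟨norm_nonneg _, h1⟩
  have hsum : Summable R := by
    rw [summable_iff_vanishing_norm]
    intro ε hε
    obtain ⟨s, hs⟩ := (summable_iff_vanishing_norm.1 hT) (ε ^ 2) (by positivity)
    refine ⟨s, fun t ht => (hbound t).trans_lt ?_⟩
    rw [Real.sqrt_lt' hε]
    exact (le_abs_self _).trans_lt (hs t ht)
  have hlim : HasSum R T := by
    have h := hsum.hasSum
    have : (∑' i, R i) = T := by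
      ext x
      have h1 : HasSum (fun i => R i x) ((∑' i, R i) x) :=
        h.mapL (ContinuousLinearMap.apply ℂ H x)
      have h2 : HasSum (fun i => R i x) (T x) := by
        have := (e.hasSum_repr x).mapL T
        simpa only [map_smul, e.repr_apply_apply, hRa] using this
      exact h1.unique h2
    rwa [this] at h
  refine isCompactOperator_of_tendsto hlim (Filter.Eventually.of_forall fun s => ?_)
  have : (∑ i ∈ s, R i) ∈ compactOperator (RingHom.id ℂ) H H := by
    refine Submodule.sum_mem _ fun i _ => ?_
    exact (isCompactOperator_of_locallyCompactSpace_rng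
      ((ContinuousLinearMap.id ℂ ℂ).smulRight (T (e i)))).comp_clm (innerSL ℂ (e i))
  exact this

/-- For a unitary representation `π` of a group `G` on a complex Hilbert space `H`, the
representation `π⊗π̄`, realized on Hilbert–Schmidt operators by `T ↦ π(x) T π(x)⁻¹`, has a
nonzero invariant vector (i.e. a nonzero Hilbert–Schmidt operator `T` with
`π(g) T π(g)* = T` for all `g`) if and only if `π` contains a nonzero finite-dimensional
subrepresentation. Hilbert–Schmidtness is expressed via a Hilbert basis `e`. -/
theorem tensor_conj_invariant_vector_iff_finite_dim_subrep
    {G H ι : Type*} [Group G]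
    [NormedAddCommGroup H] [InnerProductSpace ℂ H] [CompleteSpace H]
    (e : HilbertBasis ι ℂ H)
    (π : G → H →L[ℂ] H) (hπu : ∀ g, π g ∈ unitary (H →L[ℂ] H))
    (hπ1 : π 1 = 1) (hπm : ∀ g h, π (g * h) = π g ∘L π h) :
    (∃ T : H →L[ℂ] H, T ≠ 0 ∧ (Summable fun i => ‖T (e i)‖ ^ 2) ∧
        ∀ g, π g ∘L T ∘L adjoint (π g) = T) ↔
      (∃ V : Submodule ℂ H, V ≠ ⊥ ∧ FiniteDimensional ℂ V ∧
        ∀ g, ∀ x ∈ V, π g x ∈ V) := by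
  have hl : ∀ g x, adjoint (π g) (π g x) = x := fun g x => by
    have := (Unitary.mem_iff.1 (hπu g)).1
    exact DFunLike.congr_fun this x
  have hr : ∀ g x, π g (adjoint (π g) x) = x := fun g x => by
    have := (Unitary.mem_iff.1 (hπu g)).2
    exact DFunLike.congr_fun this x
  constructor
  · rintro ⟨T, hT0, hTs, hTi⟩
    have hTc := isCompactOperator_of_summable_sq e T hTs
    have hTcomm : ∀ g x, T (π g x) = π g (T x) := fun g x => by
      have := DFunLike.congr_fun (hTi g) (π g x)
      simp only [ContinuousLinearMap.comp_apply, hl] at this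
      exact this.symm
    have hTacomm : ∀ g x, adjoint T (π g x) = π g (adjoint T x) := fun g x => by
      refine ext_inner_left ℂ fun v => ?_
      rw [adjoint_inner_right, ← hr g v, hTcomm, ← adjoint_inner_left, hl,
        ← adjoint_inner_left (π g), hl, adjoint_inner_right]
    let S : H →L[ℂ] H := adjoint T ∘L T
    have hSc : IsCompactOperator S := hTc.clm_comp (adjoint T)
    have hSs : S.IsSymmetric := fun x y => by
      change ⟪adjoint T (T x), y⟫_ℂ = ⟪x, adjoint T (T y)⟫_ℂ
      rw [adjoint_inner_left, adjoint_inner_right]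
    have hS0 : S ≠ 0 := fun h => hT0 <| by
      ext x
      have h1 : S x = 0 := by rw [h]; rfl
      have h2 : ⟪T x, T x⟫_ℂ = 0 := by
        rw [← adjoint_inner_left]
        change ⟪S x, x⟫_ℂ = 0
        rw [h1, inner_zero_left]
      simpa using h2
    have hex := mt (ContinuousLinearMap.eq_zero_of_forall_hasEigenvalue_eq_zero hSc hSs).1 hS0
    push Not at hex
    obtain ⟨μ, hμ, hμ0⟩ := hex
    refine ⟨Module.End.eigenspace (S : Module.End ℂ H) μ, hμ,
      ContinuousLinearMap.finite_dimensional_eigenspace hSc μ hμ0, fun g x hx => ?_⟩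
    rw [Module.End.mem_eigenspace_iff] at hx ⊢
    change adjoint T (T x) = μ • x at hx
    change adjoint T (T (π g x)) = μ • π g x
    rw [hTcomm, hTacomm, hx, map_smul]
  · rintro ⟨V, hV0, hVf, hVi⟩
    have hinv : ∀ g x, adjoint (π g) x = π g⁻¹ x := fun g x => by
      have h : π g⁻¹ (π g (adjoint (π g) x)) = adjoint (π g) x := by
        rw [← ContinuousLinearMap.comp_apply, ← hπm, inv_mul_cancel, hπ1]; rfl
      rw [← h, hr]
    refine ⟨V.starProjection, fun h => hV0 ?_, ?_, fun g => ?_⟩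
    · rw [eq_bot_iff]
      intro x hx
      have := Submodule.starProjection_eq_self_iff.2 hx
      rw [h] at this
      simpa using this.symm
    · let b := stdOrthonormalBasis ℂ V
      have h : ∀ i, ‖V.starProjection (e i)‖ ^ 2 = ∑ j, ‖⟪e i, (b j : H)⟫_ℂ‖ ^ 2 := fun i => by
        rw [Submodule.starProjection_apply, ← Submodule.coe_norm, ← b.sum_sq_norm_inner_left]
        refine Finset.sum_congr rfl fun j _ => ?_
        rw [Submodule.inner_orthogonalProjectionOnto_eq_of_mem_right]
      simp only [h]
      exact summable_sum fun j _ => e.orthonormal.inner_products_summable (b j : H)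
    · ext x
      symm
      refine Submodule.eq_starProjection_of_mem_orthogonal
        (hVi g _ (Submodule.starProjection_apply_mem V _)) ?_
      rw [Submodule.mem_orthogonal]
      intro w hw
      have hx : x - π g (V.starProjection (adjoint (π g) x)) =
          π g (adjoint (π g) x - V.starProjection (adjoint (π g) x)) := by
        rw [map_sub, hr]
      change ⟪w, x - π g (V.starProjection (adjoint (π g) x))⟫_ℂ = 0
      rw [hx, ← adjoint_inner_left, hinv]
      exact (Submodule.mem_orthogonal _ _).1
        (Submodule.sub_starProjection_mem_orthogonal _) _ (hVi _ _ hw)
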